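/- Let F• : 0 → F_ℓ →^{φ_ℓ} F_{ℓ−1} → ⋯ → F_1 →^{φ_1} F_0 be an exact complex of finitely generated free S-modules. Then for almost all α, the specialized complex (F•)_α : 0 → (F_ℓ)_α →^{(φ_ℓ)_α} (F_{ℓ−1})_α → ⋯ → (F_1)_α →^{(φ_1)_α} (F_0)_α is an exact complex of free S_α-modules. -/

import Mathlib

set_option maxHeartbeats 1000000
set_option synthInstance.maxHeartbeats 1000000

noncomputable section

namespace Spl

open MvPolynomial

/-- "Q(α) holds for almost all α ∈ K^m", i.e. away from a proper algebraic
subvariety of `K^m`. -/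
def AlmostAll (K : Type) [Field K] (m : ℕ) (Q : (Fin m → K) → Prop) : Prop :=
  ∃ c : MvPolynomial (Fin m) K, c ≠ 0 ∧ ∀ α : Fin m → K, MvPolynomial.eval α c ≠ 0 → Q α

variable (k K : Type) [Field k] [Field K] [Algebra k K]

/-- the field k(u) of rational functions in u = (u_1, ..., u_m) -/
abbrev kU (m : ℕ) := FractionRing (MvPolynomial (Fin m) k)

/-- the polynomial ring R = k(u)[X_1, ..., X_n] -/
abbrev Rg (m n : ℕ) := MvPolynomial (Fin n) (kU k m)

/-- the subfield k(α) ⊆ K generated by α = (α_1, ..., α_m) over k -/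
abbrev kA {m : ℕ} (α : Fin m → K) := IntermediateField.adjoin k (Set.range α)

/-- the polynomial ring R_α = k(α)[X_1, ..., X_n] -/
abbrev Ra {m : ℕ} (n : ℕ) (α : Fin m → K) := MvPolynomial (Fin n) (kA k K α)

/-- evaluation u ↦ α, from k[u] to k(α) -/
def evalα {m : ℕ} (α : Fin m → K) : MvPolynomial (Fin m) k →+* kA k K α :=
  (MvPolynomial.aeval fun i =>
    (⟨α i, IntermediateField.subset_adjoin k (Set.range α) ⟨i, rfl⟩⟩ : kA k K α)).toRingHom

/-- the inclusion k[u][X] → R = k(u)[X] -/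
def toR (m n : ℕ) : MvPolynomial (Fin n) (MvPolynomial (Fin m) k) →+* Rg k m n :=
  MvPolynomial.map (algebraMap (MvPolynomial (Fin m) k) (kU k m))

/-- substitution u ↦ α, from k[u][X] to R_α = k(α)[X] -/
def toRa {m : ℕ} (n : ℕ) (α : Fin m → K) :
    MvPolynomial (Fin n) (MvPolynomial (Fin m) k) →+* Ra k K n α :=
  MvPolynomial.map (evalα k K α)

/-- Krull's specialization I_α = { f(α,X) | f(u,X) ∈ I ∩ k[u,X] } of an ideal I ⊆ R
(as an ideal of R_α, i.e. the ideal spanned by the specialized elements). -/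
def idealSpec {m : ℕ} (n : ℕ) (α : Fin m → K) (I : Ideal (Rg k m n)) :
    Ideal (Ra k K n α) :=
  Ideal.span (toRa k K n α '' { f | toR k m n f ∈ I })

/-- `ElemSpec k K n α f fα` : fα is the specialization of f ∈ R at α, i.e. writing
f = p(u,X)/q(u) with q(α) ≠ 0 one has fα = p(α,X)/q(α). -/
def ElemSpec {m : ℕ} (n : ℕ) (α : Fin m → K) (f : Rg k m n) (fα : Ra k K n α) : Prop :=
  ∃ (p : MvPolynomial (Fin n) (MvPolynomial (Fin m) k)) (q : MvPolynomial (Fin m) k),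
    evalα k K α q ≠ 0 ∧
    MvPolynomial.C (algebraMap (MvPolynomial (Fin m) k) (kU k m) q) * f = toR k m n p ∧
    MvPolynomial.C (evalα k K α q) * fα = toRa k K n α p

variable {k K}

/-- `LocElemSpec P ℘ a aα` : aα ∈ S_α = (R_α)_℘ is the specialization of a ∈ S = R_P,
i.e. writing a = f/g with f, g ∈ R, g ∉ P, one has g_α ∉ ℘ and aα = f_α/g_α. -/
def LocElemSpec {m n : ℕ} {α : Fin m → K} (P : Ideal (Rg k m n)) [P.IsPrime]
    (℘ : Ideal (Ra k K n α)) [℘.IsPrime]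
    {S : Type} [CommRing S] [Algebra (Rg k m n) S] [IsLocalization.AtPrime S P]
    {Sα : Type} [CommRing Sα] [Algebra (Ra k K n α) Sα] [IsLocalization.AtPrime Sα ℘]
    (a : S) (aα : Sα) : Prop :=
  ∃ (f g : Rg k m n) (fα gα : Ra k K n α) (hg : g ∈ P.primeCompl)
    (hgα : gα ∈ ℘.primeCompl),
    ElemSpec k K n α f fα ∧ ElemSpec k K n α g gα ∧
    a = IsLocalization.mk' S f ⟨g, hg⟩ ∧
    aα = IsLocalization.mk' Sα fα ⟨gα, hgα⟩

/-- entrywise specialization of matrices, relative to an element-specialization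
relation `E`. -/
def MatSpec {S T : Type} (E : S → T → Prop) {r s : ℕ}
    (A : Matrix (Fin r) (Fin s) S) (B : Matrix (Fin r) (Fin s) T) : Prop :=
  ∀ i j, E (A i j) (B i j)

/-- the cokernel of the linear map attached to a matrix A, i.e. the module
presented by A. -/
abbrev MatCoker {S : Type} [CommRing S] {r s : ℕ} (A : Matrix (Fin r) (Fin s) S) :=
  (Fin r → S) ⧸ LinearMap.range A.mulVecLin

/-- a finite free presentation F_1 → F_0 → L → 0 of the module L, where the map
F_1 → F_0 is given by the matrix A and the map F_0 → L is π. -/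
structure Present (S : Type) [CommRing S] (r s : ℕ) (L : Type) [AddCommGroup L]
    [Module S L] where
  A : Matrix (Fin r) (Fin s) S
  π : (Fin r → S) →ₗ[S] L
  surj : Function.Surjective π
  ker_eq : LinearMap.ker π = LinearMap.range A.mulVecLin

theorem comm_le {S : Type} [CommRing S] {r s r' s' : ℕ} {B : Matrix (Fin r) (Fin s) S}
    {C : Matrix (Fin r') (Fin s') S} {W : Matrix (Fin r') (Fin r) S}
    {W1 : Matrix (Fin s') (Fin s) S} (h : W * B = C * W1) :
    LinearMap.range B.mulVecLin ≤ (LinearMap.range C.mulVecLin).comap W.mulVecLin := by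
  rintro x ⟨y, rfl⟩
  exact ⟨W1.mulVecLin y, by
    simp only [Matrix.mulVecLin_apply, Matrix.mulVec_mulVec, h]⟩

/-- the map between the modules presented by B and C induced by the matrix W
(a specialization of a lift of a map between the presented modules). -/
def cokerMap {S : Type} [CommRing S] {r s r' s' : ℕ} {B : Matrix (Fin r) (Fin s) S}
    {C : Matrix (Fin r') (Fin s') S} (W : Matrix (Fin r') (Fin r) S)
    (h : LinearMap.range B.mulVecLin ≤ (LinearMap.range C.mulVecLin).comap W.mulVecLin) :
    MatCoker B →ₗ[S] MatCoker C :=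
  Submodule.mapQ _ _ W.mulVecLin h

/-- a lift of a homomorphism v : L → M to given finite free presentations of L and M:
a commutative diagram whose vertical maps are given by the matrices V1, V0. -/
structure MapLift {S : Type} [CommRing S] {rL sL rM sM : ℕ} {L M : Type}
    [AddCommGroup L] [Module S L] [AddCommGroup M] [Module S M]
    (pL : Present S rL sL L) (pM : Present S rM sM M) (v : L →ₗ[S] M) where
  V0 : Matrix (Fin rM) (Fin rL) S
  V1 : Matrix (Fin sM) (Fin sL) S
  comm0 : pM.π ∘ₗ V0.mulVecLin = v ∘ₗ pL.π
  comm1 : V0 * pL.A = pM.A * V1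

/-- Krull dimension of a module, dim L = dim S/Ann L. -/
def moduleDim (S : Type) [CommRing S] (L : Type) [AddCommGroup L] [Module S L] :
    WithBot ℕ∞ :=
  ringKrullDim (S ⧸ Module.annihilator S L)

/-- height of an ideal: the infimum of dim S_p over the primes p ⊇ I. -/
def idealHeight {S : Type} [CommRing S] (I : Ideal S) : WithBot ℕ∞ :=
  sInf { d | ∃ (p : Ideal S) (hp : p.IsPrime), I ≤ p ∧
    d = ringKrullDim (Localization (@Ideal.primeCompl _ _ p hp)) }

/-- length of a module: the longest chain of submodules. -/
def moduleLength (S : Type) [CommRing S] (L : Type) [AddCommGroup L] [Module S L] :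
    WithBot ℕ∞ :=
  Order.krullDim (Submodule S L)

/-- grade(𝔞, L) ≥ t : there is an L-regular sequence of length t in 𝔞. -/
def GradeGE {S : Type} [CommRing S] (𝔞 : Ideal S) (L : Type) [AddCommGroup L]
    [Module S L] (t : ℕ) : Prop :=
  ∃ rs : List S, rs.length = t ∧ (∀ x ∈ rs, x ∈ 𝔞) ∧ RingTheory.Sequence.IsRegular L rs

/-- grade(𝔞, L) : the length of a maximal L-regular sequence in 𝔞. -/
def grade {S : Type} [CommRing S] (𝔞 : Ideal S) (L : Type) [AddCommGroup L]
    [Module S L] : ℕ∞ :=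
  sSup { t : ℕ∞ | ∃ t' : ℕ, t = (t' : ℕ∞) ∧ GradeGE 𝔞 L t' }

/-- depth of a module over a local ring: grade(𝔪, L). -/
def depth (S : Type) [CommRing S] [IsLocalRing S] (L : Type) [AddCommGroup L]
    [Module S L] : ℕ∞ :=
  grade (IsLocalRing.maximalIdeal S) L

/-- proj dim L ≤ d : L admits a finite free resolution of length ≤ d, encoded as a
(possibly infinite) free resolution ⋯ → F_1 → F_0 → L → 0 with F_j = 0 for j > d. -/
def ProjDimLE (S : Type) [CommRing S] (L : Type) [AddCommGroup L] [Module S L]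
    (d : ℕ) : Prop :=
  ∃ (r : ℕ → ℕ) (A : ∀ j : ℕ, Matrix (Fin (r j)) (Fin (r (j + 1))) S)
    (π : (Fin (r 0) → S) →ₗ[S] L),
    Function.Surjective π ∧ LinearMap.ker π = LinearMap.range (A 0).mulVecLin ∧
    (∀ j : ℕ, LinearMap.ker (A j).mulVecLin = LinearMap.range (A (j + 1)).mulVecLin) ∧
    ∀ j : ℕ, d < j → r j = 0

/-- projective dimension of a module, as an extended natural number. -/
def projDim (S : Type) [CommRing S] (L : Type) [AddCommGroup L] [Module S L] : ℕ∞ :=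
  sInf { d : ℕ∞ | ∃ d' : ℕ, d = (d' : ℕ∞) ∧ ProjDimLE S L d' }

/-- the i-th local cohomology module H^i_𝔞(L) as a module. -/
abbrev localCoh {S : Type} [CommRing S] (𝔞 : Ideal S) (i : ℕ) (L : Type)
    [AddCommGroup L] [Module S L] : ModuleCat S :=
  (localCohomology 𝔞 i).obj (ModuleCat.of S L)

/-- the colon submodule (0 :_L 𝔞) = { x ∈ L | 𝔞 x = 0 }. -/
def colonSubmodule {S : Type} [CommRing S] (𝔞 : Ideal S) (L : Type) [AddCommGroup L]
    [Module S L] : Submodule S L where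
  carrier := { x | ∀ c ∈ 𝔞, c • x = 0 }
  add_mem' := by
    intro a b ha hb c hc
    rw [smul_add, ha c hc, hb c hc, add_zero]
  zero_mem' := by
    intro c _
    rw [smul_zero]
  smul_mem' := by
    intro s x hx c hc
    rw [smul_comm, hx c hc, smul_zero]

/-- a (partial) system of parameters: the d = dim L elements a_1, ..., a_d lie in the
maximal ideal and L/(a_1, ..., a_d)L has dimension ≤ 0. -/
def IsSOP (S : Type) [CommRing S] [IsLocalRing S] (L : Type) [AddCommGroup L]
    [Module S L] {d : ℕ} (a : Fin d → S) : Prop :=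
  (∀ i, a i ∈ IsLocalRing.maximalIdeal S) ∧
  moduleDim S L = (d : ℕ∞) ∧
  moduleDim S (L ⧸ (Ideal.span (Set.range a) • (⊤ : Submodule S L))) ≤ 0

/-- a standard system of parameters: (a_1, ..., a_d) H^i_𝔪(L/(a_1, ..., a_j)L) = 0
for all i + j < d. -/
def IsStandardSOP (S : Type) [CommRing S] [IsLocalRing S] (L : Type) [AddCommGroup L]
    [Module S L] {d : ℕ} (a : Fin d → S) : Prop :=
  IsSOP S L a ∧
  ∀ i j : ℕ, i + j < d →
    Ideal.span (Set.range a) ≤ Module.annihilator S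
      (localCoh (IsLocalRing.maximalIdeal S) i
        (L ⧸ (Ideal.span (a '' { x : Fin d | (x : ℕ) < j }) • (⊤ : Submodule S L))))

/-- a standard ideal for L: an 𝔪-primary ideal 𝔞 such that every system of
parameters of L contained in 𝔞 is standard. -/
def IsStandardIdeal (S : Type) [CommRing S] [IsLocalRing S] (L : Type) [AddCommGroup L]
    [Module S L] (𝔞 : Ideal S) : Prop :=
  𝔞.radical = IsLocalRing.maximalIdeal S ∧
  ∀ (d : ℕ) (a : Fin d → S), (∀ i, a i ∈ 𝔞) → IsSOP S L a → IsStandardSOP S L a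


/-- `J` satisfies the Artin–Rees type condition `J ∩ I M ⊆ I J` for every ideal `I` of `D`, up to
powers of `q`; equivalently, `M ⧸ J` becomes flat over `D` after inverting `q` if `M` is flat. -/
def IsPureAway {D A M : Type*} [CommRing D] [CommRing A] [Algebra D A] [AddCommGroup M]
    [Module A M] (q : D) (J : Submodule A M) : Prop :=
  ∀ I : Ideal D, ∀ x ∈ J, x ∈ I.map (algebraMap D A) • (⊤ : Submodule A M) →
    ∃ N : ℕ, (algebraMap D A q) ^ N • x ∈ I.map (algebraMap D A) • J

section
variable {D A M M' : Type*} [CommRing D] [CommRing A] [Algebra D A] [AddCommGroup M]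
    [Module A M] [AddCommGroup M'] [Module A M']

theorem IsPureAway.mul {q : D} {J : Submodule A M} (h : IsPureAway q J) (q' : D) :
    IsPureAway (q * q') J := by
  intro I x hx hxI
  obtain ⟨N, hN⟩ := h I x hx hxI
  refine ⟨N, ?_⟩
  rw [map_mul, mul_pow, mul_comm, mul_smul]
  exact Submodule.smul_mem _ _ hN

theorem IsPureAway.of_dvd {q q' : D} (hq : q ∣ q') {J : Submodule A M} (h : IsPureAway q J) :
    IsPureAway q' J := by
  obtain ⟨c, rfl⟩ := hq
  exact h.mul c

theorem IsPureAway.of_map_of_inf_ker {q : D} {J : Submodule A M} (f : M →ₗ[A] M')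
    (h₁ : IsPureAway q (J.map f)) (h₂ : IsPureAway q (J ⊓ LinearMap.ker f)) :
    IsPureAway q J := by
  intro I x hx hxI
  obtain ⟨N, hN⟩ := h₁ I (f x) (Submodule.mem_map_of_mem hx) (by
    have := Submodule.mem_map_of_mem (f := f) hxI
    rw [Submodule.map_smul''] at this
    exact Submodule.smul_mono le_rfl le_top this)
  rw [← Submodule.map_smul''] at hN
  obtain ⟨y, hy, hyx⟩ := hN
  obtain ⟨N', hN'⟩ := h₂ I ((algebraMap D A q) ^ N • x - y)
    ⟨J.sub_mem (J.smul_mem _ hx) (Submodule.smul_le_right hy), by simp [hyx]⟩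
    (Submodule.sub_mem _ (Submodule.smul_mem _ _ hxI) (Submodule.smul_mono le_rfl le_top hy))
  refine ⟨N' + N, ?_⟩
  have := Submodule.add_mem _ (Submodule.smul_mono le_rfl inf_le_left hN')
    (Submodule.smul_mem _ ((algebraMap D A q) ^ N') hy)
  rwa [smul_sub, sub_add_cancel, smul_smul, ← pow_add] at this

theorem IsPureAway.map_of_leftInverse {q : D} {J : Submodule A M} (h : IsPureAway q J)
    (i : M →ₗ[A] M') (p : M' →ₗ[A] M) (hpi : ∀ x, p (i x) = x) :
    IsPureAway q (J.map i) := by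
  rintro I _ ⟨x, hx, rfl⟩ hxI
  obtain ⟨N, hN⟩ := h I x hx (by
    have := Submodule.mem_map_of_mem (f := p) hxI
    rw [Submodule.map_smul'', hpi] at this
    exact Submodule.smul_mono le_rfl le_top this)
  refine ⟨N, ?_⟩
  rw [← map_smul, ← Submodule.map_smul'']
  exact Submodule.mem_map_of_mem hN

end

/-- Every ideal of `A` becomes pure over `D` after inverting a nonzero element of `D`. -/
def GenericallyPure (D A : Type*) [CommRing D] [CommRing A] [Algebra D A] : Prop :=
  ∀ J : Ideal A, ∃ q : D, q ≠ 0 ∧ IsPureAway q J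

theorem GenericallyPure.self (D : Type*) [CommRing D] [IsDomain D] : GenericallyPure D D := by
  intro J
  by_cases hJ : J = ⊥
  · exact ⟨1, one_ne_zero, fun I x hx _ => ⟨0, by subst hJ; simp_all⟩⟩
  · obtain ⟨q, hqJ, hq⟩ := Submodule.exists_mem_ne_zero_of_ne_bot hJ
    refine ⟨q, hq, fun I x hx hxI => ⟨1, ?_⟩⟩
    have hxI' : x ∈ I.map (algebraMap D D) := by simpa [Algebra.algebraMap_self] using hxI
    rw [pow_one, Algebra.algebraMap_self, RingHom.id_apply, smul_eq_mul, smul_eq_mul, mul_comm q]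
    exact Ideal.mul_mem_mul (by simpa using hxI') hqJ

theorem GenericallyPure.of_algEquiv {D A A' : Type*} [CommRing D] [CommRing A] [Algebra D A]
    [CommRing A'] [Algebra D A'] (h : GenericallyPure D A) (e : A ≃ₐ[D] A') :
    GenericallyPure D A' := by
  intro J
  obtain ⟨q, hq, hJ⟩ := h (J.comap e)
  refine ⟨q, hq, fun I x hx hxI => ?_⟩
  rw [smul_eq_mul, Ideal.mul_top] at hxI
  have hmap : (I.map (algebraMap D A)).map e = I.map (algebraMap D A') := by
    rw [← e.toAlgHom.comp_algebraMap, ← Ideal.map_map]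
    rfl
  have hmap' : (I.map (algebraMap D A')).map e.symm = I.map (algebraMap D A) := by
    rw [← e.symm.toAlgHom.comp_algebraMap, ← Ideal.map_map]
    rfl
  obtain ⟨N, hN⟩ := hJ I (e.symm x) (by simpa [Ideal.mem_comap] using hx) (by
    rw [smul_eq_mul, Ideal.mul_top, ← hmap']
    exact Ideal.mem_map_of_mem _ hxI)
  refine ⟨N, ?_⟩
  have := Ideal.mem_map_of_mem e hN
  rw [smul_eq_mul, Ideal.map_mul, hmap] at this
  simpa using Ideal.mul_mono_right Ideal.map_comap_le this

open Polynomial in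
theorem GenericallyPure.polynomial {D A : Type*} [CommRing D] [IsDomain D] [CommRing A]
    [IsNoetherianRing A] [Algebra D A] (h : GenericallyPure D A) : GenericallyPure D A[X] := by
  intro J
  choose q hq hpure using fun i => h (J.leadingCoeffNth i)
  obtain ⟨n₀, hn₀⟩ := monotone_stabilizes_iff_noetherian.mpr ‹IsNoetherianRing A›
    ⟨J.leadingCoeffNth, fun _ _ hij => J.leadingCoeffNth_mono hij⟩
  have hn₀' : ∀ i, n₀ ≤ i → J.leadingCoeffNth n₀ = J.leadingCoeffNth i := hn₀
  set Q := ∏ i ∈ Finset.range (n₀ + 1), q i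
  have hQpure : ∀ i, IsPureAway Q (J.leadingCoeffNth i) := by
    intro i
    rcases le_total n₀ i with hi | hi
    · rw [← hn₀' i hi]
      exact (hpure n₀).of_dvd (Finset.dvd_prod_of_mem q (by simp))
    · exact (hpure i).of_dvd (Finset.dvd_prod_of_mem q (by simp; omega))
  have hmap (I : Ideal D) : I.map (algebraMap D A[X]) = (I.map (algebraMap D A)).map Polynomial.C := by
    rw [Ideal.map_map]; rfl
  refine ⟨Q, Finset.prod_ne_zero_iff.2 fun i _ => hq i, fun I x hx hxI => ?_⟩
  rw [smul_eq_mul, Ideal.mul_top] at hxI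
  suffices H : ∀ n, ∀ x ∈ J, x ∈ I.map (algebraMap D A[X]) → (∀ i, n ≤ i → x.coeff i = 0) →
      ∃ N : ℕ, (algebraMap D A[X] Q) ^ N * x ∈ I.map (algebraMap D A[X]) • J from
    H (x.natDegree + 1) x hx hxI fun i hi => coeff_eq_zero_of_natDegree_lt hi
  intro n
  induction n with
  | zero =>
    intro x _ _ hx0
    have : x = 0 := by ext i; simpa using hx0 i (Nat.zero_le _)
    exact ⟨0, by simp [this]⟩
  | succ n ih =>
    intro x hx hxI hxn
    have hxI' := hxI
    rw [hmap, Ideal.mem_map_C_iff] at hxI'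
    have hdeg : x ∈ J.degreeLE n := by
      refine ⟨mem_degreeLE.2 ((degree_le_iff_coeff_zero _ _).2 fun i hi => hxn i ?_), hx⟩
      exact_mod_cast hi
    obtain ⟨N, hN⟩ := hQpure n I (x.coeff n) ⟨x, hdeg, rfl⟩ (by simpa using hxI' n)
    rw [Ideal.leadingCoeffNth, ← Submodule.map_smul''] at hN
    obtain ⟨y, hy, hyx⟩ := hN
    have hyJ : y ∈ I.map (algebraMap D A[X]) * J := by
      refine Submodule.smul_induction_on hy (fun a ha b hb => ?_) fun _ _ => add_mem
      rw [← Polynomial.C_mul', hmap]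
      exact Ideal.mul_mem_mul (Ideal.mem_map_of_mem _ ha) hb.2
    have hyI : y ∈ I.map (algebraMap D A[X]) := Ideal.mul_le_left hyJ
    have hyn : y ∈ J.degreeLE n := Submodule.smul_le_right hy
    obtain ⟨N', hN'⟩ := ih ((algebraMap D A[X] Q) ^ N * x - y)
      (sub_mem (J.mul_mem_left _ hx) hyn.2)
      (sub_mem (Ideal.mul_mem_left _ _ hxI) hyI) (by
        intro i hi
        have hc : algebraMap D A[X] Q = Polynomial.C (algebraMap D A Q) := rfl
        rw [Polynomial.coeff_sub, hc, ← Polynomial.C_pow, Polynomial.coeff_C_mul]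
        rcases hi.eq_or_lt with rfl | hi
        · simpa [sub_eq_zero] using hyx.symm
        · rw [hxn i hi, (degree_le_iff_coeff_zero _ _).1 (mem_degreeLE.1 hyn.1) i
            (by exact_mod_cast hi)]
          simp)
    refine ⟨N' + N, ?_⟩
    rw [smul_eq_mul] at hN'
    have := Ideal.add_mem _ hN' (Ideal.mul_mem_left _ ((algebraMap D A[X] Q) ^ N') hyJ)
    rwa [mul_sub, sub_add_cancel, ← mul_assoc, ← pow_add] at this

theorem GenericallyPure.mvPolynomial (D : Type*) [CommRing D] [IsDomain D] [IsNoetherianRing D]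
    (n : ℕ) : GenericallyPure D (MvPolynomial (Fin n) D) := by
  induction n with
  | zero => exact (GenericallyPure.self D).of_algEquiv (isEmptyAlgEquiv D (Fin 0)).symm
  | succ n ih => exact ih.polynomial.of_algEquiv (finSuccEquiv D n).symm

theorem GenericallyPure.exists_isPureAway {D A : Type*} [CommRing D] [IsDomain D] [CommRing A]
    [Algebra D A] (h : GenericallyPure D A) {r : ℕ} (J : Submodule A (Fin r → A)) :
    ∃ q : D, q ≠ 0 ∧ IsPureAway q J := by
  induction r with
  | zero =>
    refine ⟨1, one_ne_zero, fun I x _ _ => ⟨0, ?_⟩⟩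
    rw [Subsingleton.elim (_ • x) 0]
    exact zero_mem _
  | succ r ih =>
    let p : (Fin (r + 1) → A) →ₗ[A] (Fin r → A) := LinearMap.funLeft A A Fin.succ
    let i : (Fin r → A) →ₗ[A] (Fin (r + 1) → A) :=
      LinearMap.pi (Fin.cons 0 fun j => LinearMap.proj j)
    have hi0 : ∀ x, i x 0 = 0 := fun x => by simp [i]
    have his : ∀ x j, i x (Fin.succ j) = x j := fun x j => by simp [i]
    obtain ⟨q, hq, hJ⟩ := ih (J.comap i)
    obtain ⟨q', hq', hJ'⟩ := h (J.map (LinearMap.proj 0))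
    refine ⟨q * q', mul_ne_zero hq hq', .of_map_of_inf_ker (LinearMap.proj 0)
      (hJ'.of_dvd (Dvd.intro_left _ rfl)) ?_⟩
    have : J ⊓ LinearMap.ker (LinearMap.proj 0) = (J.comap i).map i := by
      rw [Submodule.map_comap_eq, inf_comm]
      congr 1
      ext x
      refine ⟨fun hx => ⟨p x, ?_⟩, ?_⟩
      · ext j
        refine Fin.cases ?_ (fun j => ?_) j
        · simpa [hi0] using hx.symm
        · simp [his, p, LinearMap.funLeft_apply]
      · rintro ⟨y, rfl⟩
        exact hi0 y
    rw [this]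
    exact (hJ.mul q').map_of_leftInverse i p fun x => by
      ext j; simp [his, p, LinearMap.funLeft_apply]

theorem exists_common_denom {T S : Type*} [CommRing T] [CommRing S] (θ : T →+* S)
    (M : Submonoid T) (h : ∀ a, ∃ s ∈ M, ∃ p, θ s * a = θ p) {ι : Type*} [Finite ι] (f : ι → S) :
    ∃ s ∈ M, ∃ p : ι → T, ∀ i, θ s * f i = θ (p i) := by
  classical
  cases nonempty_fintype ι
  choose s hs p hp using fun i => h (f i)
  refine ⟨∏ i, s i, prod_mem fun i _ => hs i, fun i => (∏ j ∈ Finset.univ.erase i, s j) * p i,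
    fun i => ?_⟩
  rw [← Finset.mul_prod_erase _ _ (Finset.mem_univ i), map_mul, map_mul, ← hp i]
  ring

theorem exists_denom_mvPolynomial_map {D L σ : Type*} [CommRing D] [CommRing L] (θ : D →+* L)
    (M : Submonoid D) (h : ∀ a, ∃ s ∈ M, ∃ p, θ s * a = θ p) (x : MvPolynomial σ L) :
    ∃ s ∈ M.map (C : D →+* MvPolynomial σ D),
      ∃ p, MvPolynomial.map θ s * x = MvPolynomial.map θ p := by
  induction x using MvPolynomial.induction_on with
  | C a =>
    obtain ⟨s, hs, p, hp⟩ := h a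
    exact ⟨C s, ⟨s, hs, rfl⟩, C p, by simp [← C_mul, hp]⟩
  | add x y hx hy =>
    obtain ⟨s, hs, p, hp⟩ := hx
    obtain ⟨t, ht, p', hp'⟩ := hy
    refine ⟨s * t, mul_mem hs ht, t * p + s * p', ?_⟩
    simp only [map_mul, map_add, ← hp, ← hp']
    ring
  | mul_X x i hx =>
    obtain ⟨s, hs, p, hp⟩ := hx
    exact ⟨s, hs, p * X i, by rw [map_mul, ← hp, map_X, mul_assoc]⟩

theorem mem_ideal_smul_top_pi {A ι : Type*} [CommRing A] [Fintype ι] (I : Ideal A)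
    (x : ι → A) (hx : ∀ i, x i ∈ I) : x ∈ I • (⊤ : Submodule A (ι → A)) := by
  classical
  rw [pi_eq_sum_univ x]
  exact Submodule.sum_mem _ fun i _ => Submodule.smul_mem_smul (hx i) trivial

/-- Outside the zeros of some `q ≠ 0`, every solution of a specialized homogeneous linear system is,
up to a nonzero scalar, the specialization of a solution of the original system. -/
theorem exists_generic_ker_lift {D : Type*} [CommRing D] [IsDomain D] [IsNoetherianRing D]
    {n r₀ r₁ : ℕ} (A : Matrix (Fin r₀) (Fin r₁) (MvPolynomial (Fin n) D)) :
    ∃ q : D, q ≠ 0 ∧ ∀ {L : Type} [Field L] (ev : D →+* L),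
      (∀ c, ∃ s ∈ (nonZeroDivisors L).comap ev, ∃ p, ev s * c = ev p) → ev q ≠ 0 →
      ∀ x : Fin r₁ → MvPolynomial (Fin n) L, (A.map (MvPolynomial.map ev)).mulVec x = 0 →
        ∃ y : Fin r₁ → MvPolynomial (Fin n) D, A.mulVec y = 0 ∧
          ∃ c : L, c ≠ 0 ∧ ∀ i, MvPolynomial.map ev (y i) = C c * x i := by
  obtain ⟨q, hq, hpure⟩ :=
    (GenericallyPure.mvPolynomial D n).exists_isPureAway (LinearMap.range A.mulVecLin)
  refine ⟨q, hq, fun {L} _ ev hev hevq x hx => ?_⟩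
  obtain ⟨_, ⟨b, hb, rfl⟩, y, hy⟩ :=
    exists_common_denom _ _ (exists_denom_mvPolynomial_map (σ := Fin n) ev _ hev) x
  have hb : ev b ≠ 0 := nonZeroDivisors.ne_zero hb
  have hmap : (RingHom.ker ev).map (algebraMap D (MvPolynomial (Fin n) D)) =
      RingHom.ker (MvPolynomial.map ev : MvPolynomial (Fin n) D →+* _) := by
    rw [MvPolynomial.ker_map]; rfl
  have hyx : MvPolynomial.map ev ∘ y = (C (ev b) : MvPolynomial (Fin n) L) • x := by
    ext1 i
    simpa using (hy i).symm
  obtain ⟨N, hN⟩ := hpure (RingHom.ker ev) (A.mulVecLin y) ⟨y, rfl⟩ (by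
    refine mem_ideal_smul_top_pi _ _ fun i => ?_
    rw [hmap, RingHom.mem_ker, Matrix.mulVecLin_apply, RingHom.map_mulVec, hyx,
      Matrix.mulVec_smul, hx]
    simp)
  rw [LinearMap.range_eq_map, ← Submodule.map_smul''] at hN
  obtain ⟨z, hz, hzy⟩ := hN
  have hz0 : ∀ i, MvPolynomial.map ev (z i) = 0 := by
    intro i
    rw [← RingHom.mem_ker, ← hmap]
    refine Submodule.smul_induction_on hz (fun a ha b _ => ?_) fun a b ha hb => ?_
    · exact Ideal.mul_mem_right _ _ ha
    · exact add_mem ha hb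
  refine ⟨(algebraMap D (MvPolynomial (Fin n) D) q) ^ N • y - z, ?_, ev q ^ N * ev b,
    mul_ne_zero (pow_ne_zero _ hevq) hb, fun i => ?_⟩
  · rw [← Matrix.mulVecLin_apply, map_sub, hzy, map_smul, sub_self]
  · have := hy i
    simp only [MvPolynomial.map_C] at this
    simp only [Pi.sub_apply, Pi.smul_apply, smul_eq_mul, map_sub, map_mul, hz0, ← this, map_pow,
      MvPolynomial.algebraMap_eq, MvPolynomial.map_C, sub_zero]
    ring

section AlmostAll

variable {K : Type} [Field K] {m : ℕ} {Q Q' : (Fin m → K) → Prop}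

theorem AlmostAll.mono (h : AlmostAll K m Q) (hQ : ∀ α, Q α → Q' α) : AlmostAll K m Q' := by
  obtain ⟨c, hc, h⟩ := h
  exact ⟨c, hc, fun α hα => hQ α (h α hα)⟩

theorem AlmostAll.and (h : AlmostAll K m Q) (h' : AlmostAll K m Q') :
    AlmostAll K m fun α => Q α ∧ Q' α := by
  obtain ⟨c, hc, h⟩ := h
  obtain ⟨c', hc', h'⟩ := h'
  refine ⟨c * c', mul_ne_zero hc hc', fun α hα => ?_⟩
  rw [map_mul] at hα
  exact ⟨h α (left_ne_zero_of_mul hα), h' α (right_ne_zero_of_mul hα)⟩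

theorem AlmostAll.forall_lt {Q : ℕ → (Fin m → K) → Prop} {N : ℕ}
    (h : ∀ j < N, AlmostAll K m (Q j)) : AlmostAll K m fun α => ∀ j < N, Q j α := by
  induction N with
  | zero => exact ⟨1, one_ne_zero, fun α _ j hj => absurd hj (Nat.not_lt_zero j)⟩
  | succ N ih =>
    refine ((ih fun j hj => h j (hj.trans N.lt_succ_self)).and (h N N.lt_succ_self)).mono ?_
    rintro α ⟨h₁, h₂⟩ j hj
    rcases (Nat.lt_succ_iff_lt_or_eq.1 hj) with hj | rfl
    exacts [h₁ j hj, h₂]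

theorem coe_evalα (k K : Type) [Field k] [Field K] [Algebra k K] {m : ℕ} (α : Fin m → K)
    (p : MvPolynomial (Fin m) k) : (evalα k K α p : K) = MvPolynomial.aeval α p := by
  change (kA k K α).val (MvPolynomial.aeval _ p) = _
  rw [MvPolynomial.comp_aeval_apply]
  rfl

theorem almostAll_evalα_ne_zero (k K : Type) [Field k] [Field K] [Algebra k K] {m : ℕ}
    {q : MvPolynomial (Fin m) k} (hq : q ≠ 0) : AlmostAll K m fun α => evalα k K α q ≠ 0 := by
  refine ⟨MvPolynomial.map (algebraMap k K) q,
    (map_ne_zero_iff _ (MvPolynomial.map_injective _ (algebraMap k K).injective)).2 hq,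
    fun α hα h => hα ?_⟩
  rw [MvPolynomial.eval_map, ← MvPolynomial.aeval_def, ← coe_evalα, h]
  rfl

end AlmostAll

section Specialization

variable {k K : Type} [Field k] [Field K] [Algebra k K] {m n : ℕ}

theorem exists_denom_evalα (α : Fin m → K) (c : kA k K α) :
    ∃ s ∈ (nonZeroDivisors (kA k K α)).comap (evalα k K α),
      ∃ p, evalα k K α s * c = evalα k K α p := by
  obtain ⟨r, s, hrs⟩ := (IntermediateField.mem_adjoin_range_iff k α c.1).1 c.2
  by_cases hs : MvPolynomial.aeval α s = 0
  · refine ⟨1, one_mem _, 0, ?_⟩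
    rw [map_one, one_mul, map_zero]
    ext
    rw [hrs, hs, div_zero]
    rfl
  · refine ⟨s, mem_nonZeroDivisors_of_ne_zero fun h => hs ?_, r, ?_⟩
    · rw [← coe_evalα, h]; rfl
    · ext
      change (evalα k K α s : K) * (c : K) = (evalα k K α r : K)
      rw [coe_evalα, coe_evalα, hrs, mul_div_cancel₀ _ hs]

theorem toR_injective (k : Type) [Field k] (m n : ℕ) : Function.Injective (toR k m n) :=
  MvPolynomial.map_injective _ (IsFractionRing.injective _ _)

theorem exists_denom_toR (f : Rg k m n) :
    ∃ b : MvPolynomial (Fin m) k, b ≠ 0 ∧ ∃ p, toR k m n (C b) * f = toR k m n p := by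
  obtain ⟨_, ⟨b, hb, rfl⟩, p, hp⟩ := exists_denom_mvPolynomial_map
    (algebraMap (MvPolynomial (Fin m) k) (kU k m)) (nonZeroDivisors _) (fun a => by
      obtain ⟨⟨p, s⟩, hs⟩ := IsLocalization.surj (nonZeroDivisors (MvPolynomial (Fin m) k)) a
      exact ⟨s, s.2, p, by rw [mul_comm]; exact hs⟩) f
  exact ⟨b, nonZeroDivisors.ne_zero hb, p, hp⟩

theorem isUnit_toR_C {b : MvPolynomial (Fin m) k} (hb : b ≠ 0) : IsUnit (toR k m n (C b)) := by
  rw [toR, MvPolynomial.map_C]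
  exact ((map_ne_zero_iff _ (IsFractionRing.injective _ _)).2 hb).isUnit.map C

variable {P : Ideal (Rg k m n)} [P.IsPrime]

theorem algebraMap_toR_injective (P : Ideal (Rg k m n)) [P.IsPrime] (S : Type) [CommRing S]
    [Algebra (Rg k m n) S] [IsLocalization.AtPrime S P] :
    Function.Injective ((algebraMap (Rg k m n) S).comp (toR k m n)) :=
  (IsLocalization.injective S P.primeCompl_le_nonZeroDivisors).comp (toR_injective k m n)

theorem exists_denom_algebraMap_toR (P : Ideal (Rg k m n)) [P.IsPrime] {S : Type} [CommRing S]
    [Algebra (Rg k m n) S] [IsLocalization.AtPrime S P] (a : S) :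
    ∃ s ∈ P.primeCompl.comap (toR k m n), ∃ p,
      (algebraMap (Rg k m n) S).comp (toR k m n) s * a =
        (algebraMap (Rg k m n) S).comp (toR k m n) p := by
  obtain ⟨⟨f, g⟩, hfg⟩ := IsLocalization.surj P.primeCompl a
  obtain ⟨b, hb, p, hp⟩ := exists_denom_toR f
  obtain ⟨b', hb', p', hp'⟩ := exists_denom_toR g.1
  refine ⟨C b * p', ?_, C b' * p, ?_⟩
  · change toR k m n (C b * p') ∈ P.primeCompl
    rw [map_mul, ← hp']
    have h (x) (hx : IsUnit x) : x ∈ P.primeCompl := fun h =>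
      Ideal.IsPrime.ne_top ‹_› (P.eq_top_of_isUnit_mem h hx)
    exact mul_mem (h _ (isUnit_toR_C hb)) (mul_mem (h _ (isUnit_toR_C hb')) g.2)
  · simp only [RingHom.comp_apply, map_mul, ← hp, ← hp'] at hfg ⊢
    rw [← hfg]
    ring

theorem LocElemSpec.map_mul_eq {α : Fin m → K} {℘ : Ideal (Ra k K n α)} [℘.IsPrime]
    {S : Type} [CommRing S] [Algebra (Rg k m n) S] [IsLocalization.AtPrime S P]
    {Sα : Type} [CommRing Sα] [Algebra (Ra k K n α) Sα] [IsLocalization.AtPrime Sα ℘]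
    {a : S} {aα : Sα} (h : LocElemSpec P ℘ a aα) {s p}
    (hsp : algebraMap (Rg k m n) S (toR k m n s) * a = algebraMap (Rg k m n) S (toR k m n p)) :
    algebraMap (Ra k K n α) Sα (toRa k K n α s) * aα =
      algebraMap (Ra k K n α) Sα (toRa k K n α p) := by
  obtain ⟨f, g, fα, gα, hg, hgα, ⟨pf, qf, hqf, hf, hfα⟩, ⟨pg, qg, hqg, hg', hgα'⟩, rfl, rfl⟩ := h
  have hC (q) : C (algebraMap (MvPolynomial (Fin m) k) (kU k m) q) = toR k m n (C q) := by
    rw [toR, MvPolynomial.map_C]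
  have hCα (q) : C (evalα k K α q) = toRa k K n α (C q) := by
    rw [toRa, MvPolynomial.map_C]
  rw [hC] at hf hg'
  rw [hCα] at hfα hgα'
  have h₁ : toR k m n s * f = toR k m n p * g := by
    refine IsLocalization.injective S P.primeCompl_le_nonZeroDivisors ?_
    have := IsLocalization.mk'_spec S f (⟨g, hg⟩ : P.primeCompl)
    rw [map_mul, map_mul, ← hsp, ← this]
    ring
  have h₂ : s * pf * C qg = p * pg * C qf := by
    apply toR_injective k m n
    simp only [map_mul, ← hf, ← hg']
    linear_combination toR k m n (C qf) * toR k m n (C qg) * h₁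
  have hunit {q} (hq : evalα k K α q ≠ 0) : toRa k K n α (C q) ≠ 0 := by
    rw [← hCα]
    exact (map_ne_zero_iff _ (C_injective _ _)).2 hq
  have h₃ : toRa k K n α s * fα = toRa k K n α p * gα := by
    have := congrArg (toRa k K n α) h₂
    simp only [map_mul, ← hfα, ← hgα'] at this
    apply mul_left_cancel₀ (mul_ne_zero (hunit hqf) (hunit hqg))
    linear_combination this
  have h₄ := IsLocalization.mk'_spec Sα fα (⟨gα, hgα⟩ : ℘.primeCompl)
  apply (IsLocalization.map_units Sα (⟨gα, hgα⟩ : ℘.primeCompl)).mul_right_cancel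
  rw [mul_assoc, h₄, ← map_mul, h₃, map_mul]

theorem almostAll_notMem_isAssociatedPrime (K : Type) [Field K] [Algebra k K]
    (P : Ideal (Rg k m n)) {s : MvPolynomial (Fin n) (MvPolynomial (Fin m) k)}
    [P.IsPrime] (hs : toR k m n s ∉ P) :
    AlmostAll K m fun α => ∀ ℘ : Ideal (Ra k K n α),
      IsAssociatedPrime ℘ (Ra k K n α ⧸ idealSpec k K n α P) → toRa k K n α s ∉ ℘ := by
  obtain ⟨l, p, hp⟩ := Submodule.fg_iff_exists_fin_generating_family.1
    ((isNoetherianRing_iff_ideal_fg _).1 inferInstance (P.comap (toR k m n)))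
  obtain ⟨q, hq, h⟩ := exists_generic_ker_lift
    (Matrix.of fun (_ : Fin 1) => (Fin.cons s p : Fin (l + 1) → _))
  refine (almostAll_evalα_ne_zero k K hq).mono fun α hα ℘ h℘ hmem => ?_
  have hspec : idealSpec k K n α P = Ideal.span (Set.range fun i => toRa k K n α (p i)) := by
    change Ideal.map (toRa k K n α) (P.comap (toR k m n)) = _
    rw [← hp, ← Ideal.span, Ideal.map_span, ← Set.range_comp]
    rfl
  obtain ⟨hprime, y, hy⟩ := isAssociatedPrime_iff.1 h℘
  obtain ⟨y, rfl⟩ := Ideal.Quotient.mk_surjective y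
  have hsy : toRa k K n α s * y ∈ idealSpec k K n α P := by
    rw [hy, Submodule.mem_colon_singleton, Submodule.mem_bot] at hmem
    rw [← Ideal.Quotient.eq_zero_iff_mem, map_mul]
    exact hmem
  rw [hspec, Ideal.span, Submodule.mem_span_range_iff_exists_fun] at hsy
  obtain ⟨c, hc⟩ := hsy
  obtain ⟨x, hx, b, hb, hxb⟩ := h (evalα k K α) (exists_denom_evalα α) hα
    (Fin.cons y fun i => - c i) (by
      ext1 i
      simp only [Matrix.mulVec, dotProduct, Fin.sum_univ_succ, Matrix.map_apply, Matrix.of_apply,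
        Fin.cons_zero, Fin.cons_succ, Pi.zero_apply, mul_neg, Finset.sum_neg_distrib]
      rw [← sub_eq_add_neg, sub_eq_zero]
      change toRa k K n α s * y = _
      rw [← hc]
      exact Finset.sum_congr rfl fun i _ => by rw [smul_eq_mul, mul_comm]; rfl)
  have hx0 : toR k m n (x 0) ∈ P := by
    have := congrFun hx 0
    simp only [Matrix.mulVec, dotProduct, Fin.sum_univ_succ, Matrix.of_apply,
        Fin.cons_zero, Fin.cons_succ, Pi.zero_apply] at this
    have hsum : ∑ i, p i * x (Fin.succ i) ∈ P.comap (toR k m n) :=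
      sum_mem fun i _ => Ideal.mul_mem_right _ _ (hp ▸ Submodule.subset_span ⟨i, rfl⟩)
    have hsx : s * x 0 ∈ P.comap (toR k m n) := by
      rw [eq_neg_of_add_eq_zero_left this]
      exact neg_mem hsum
    rw [Ideal.mem_comap, map_mul] at hsx
    exact (Ideal.IsPrime.mem_or_mem ‹_› hsx).resolve_left hs
  have hyP : y ∈ idealSpec k K n α P := by
    have h₁ : toRa k K n α (x 0) ∈ idealSpec k K n α P := Ideal.subset_span ⟨_, hx0, rfl⟩
    have h₂ : toRa k K n α (x 0) = C b * y := hxb 0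
    rw [h₂] at h₁
    simpa [← mul_assoc, ← C_mul, inv_mul_cancel₀ hb] using Ideal.mul_mem_left _ (C b⁻¹) h₁
  apply hprime.ne_top
  rw [hy, Ideal.Quotient.eq_zero_iff_mem.2 hyP]
  simp

theorem exists_denom_matrix {T S : Type*} [CommRing T] [CommRing S] (θ : T →+* S)
    (M : Submonoid T) (h : ∀ a, ∃ s ∈ M, ∃ p, θ s * a = θ p) {ι κ : Type*} [Finite ι] [Finite κ]
    (A : Matrix ι κ S) :
    ∃ s ∈ M, ∃ A' : Matrix ι κ T, A'.map θ = θ s • A := by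
  obtain ⟨s, hs, p, hp⟩ := exists_common_denom θ M h fun i : ι × κ => A i.1 i.2
  exact ⟨s, hs, .of fun i j => p (i, j), by ext i j; simp [hp (i, j)]⟩

theorem mul_eq_zero_of_range_mulVecLin_le {S : Type} [CommRing S] {r₀ r₁ r₂ : ℕ}
    {A : Matrix (Fin r₀) (Fin r₁) S} {A' : Matrix (Fin r₁) (Fin r₂) S}
    (h : LinearMap.range A'.mulVecLin ≤ LinearMap.ker A.mulVecLin) : A * A' = 0 := by
  apply Matrix.toLin'.injective
  rw [Matrix.toLin'_mul, map_zero]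
  exact LinearMap.range_le_ker_iff.1 h

theorem almostAll_ker_eq_range (K : Type) [Field K] [Algebra k K]
    (P : Ideal (Rg k m n)) [P.IsPrime] {S : Type} [CommRing S] [Algebra (Rg k m n) S]
    [IsLocalization.AtPrime S P] {r₀ r₁ r₂ : ℕ}
    {A : Matrix (Fin r₀) (Fin r₁) S} {A' : Matrix (Fin r₁) (Fin r₂) S}
    (hA : LinearMap.ker A.mulVecLin = LinearMap.range A'.mulVecLin) :
    AlmostAll K m fun α => ∀ (℘ : Ideal (Ra k K n α))
      (h℘ : IsAssociatedPrime ℘ (Ra k K n α ⧸ idealSpec k K n α P)),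
        haveI := h℘.isPrime
        ∀ (Sα : Type) [CommRing Sα] [Algebra (Ra k K n α) Sα] [IsLocalization.AtPrime Sα ℘]
          (B : Matrix (Fin r₀) (Fin r₁) Sα) (B' : Matrix (Fin r₁) (Fin r₂) Sα),
          MatSpec (LocElemSpec P ℘) A B → MatSpec (LocElemSpec P ℘) A' B' →
          LinearMap.ker B.mulVecLin = LinearMap.range B'.mulVecLin := by
  let θ := (algebraMap (Rg k m n) S).comp (toR k m n)
  have hθ : Function.Injective θ := algebraMap_toR_injective P S
  have hden : ∀ a, ∃ s ∈ P.primeCompl.comap (toR k m n), ∃ p, θ s * a = θ p :=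
    exists_denom_algebraMap_toR P
  obtain ⟨s, hs, M, hM⟩ := exists_denom_matrix θ _ hden A
  obtain ⟨s', hs', M', hM'⟩ := exists_denom_matrix θ _ hden A'
  obtain ⟨l, y, hy⟩ := Submodule.fg_iff_exists_fin_generating_family.1
    (IsNoetherian.noetherian (LinearMap.ker M.mulVecLin))
  have hyA (i) : θ ∘ y i ∈ LinearMap.range A'.mulVecLin := by
    rw [← hA]
    have hyi : M.mulVec (y i) = 0 := by
      have : y i ∈ LinearMap.ker M.mulVecLin := hy ▸ Submodule.subset_span ⟨i, rfl⟩
      exact this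
    have hu : IsUnit (θ s) := IsLocalization.map_units S (⟨_, hs⟩ : P.primeCompl)
    have : θ s • A.mulVec (θ ∘ y i) = 0 := by
      rw [← Matrix.smul_mulVec, ← hM]
      ext1 j
      rw [← RingHom.map_mulVec, hyi]
      simp
    exact hu.smul_eq_zero.1 this
  choose w hw using hyA
  obtain ⟨t, ht, v, hv⟩ := exists_denom_matrix θ _ hden (Matrix.of w)
  have hker (z) (hz : M.mulVec z = 0) : ∃ u, M'.mulVec u = (t * s') • z := by
    have hle : LinearMap.ker M.mulVecLin ≤ (LinearMap.range M'.mulVecLin).comap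
        (LinearMap.lsmul _ _ (t * s')) := by
      rw [← hy, Submodule.span_le]
      rintro _ ⟨i, rfl⟩
      refine ⟨v i, ?_⟩
      ext1 j
      apply hθ
      have h₁ : θ ∘ v i = θ t • w i := congrFun hv i
      rw [Matrix.mulVecLin_apply, RingHom.map_mulVec, hM', h₁, Matrix.smul_mulVec,
        Matrix.mulVec_smul, ← Matrix.mulVecLin_apply, hw]
      simp
      ring
    exact hle hz
  have hMM' : M * M' = 0 := by
    apply Matrix.map_injective hθ
    beta_reduce
    rw [Matrix.map_mul, hM, hM', Matrix.smul_mul, Matrix.mul_smul,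
      mul_eq_zero_of_range_mulVecLin_le hA.ge]
    simp
  obtain ⟨q, hq, hlift⟩ := exists_generic_ker_lift M
  have hst : toR k m n (s * s' * t) ∉ P := mul_mem (mul_mem hs hs') ht
  refine ((almostAll_evalα_ne_zero k K hq).and
    (almostAll_notMem_isAssociatedPrime K P hst)).mono ?_
  rintro α ⟨hα, hstα⟩ ℘ h℘ Sα _ _ _ B B' hB hB'
  have := h℘.isPrime
  let ψ := (algebraMap (Ra k K n α) Sα).comp (toRa k K n α)
  have hu : IsUnit (ψ (s * s' * t)) :=
    IsLocalization.map_units Sα (⟨_, hstα ℘ h℘⟩ : ℘.primeCompl)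
  rw [map_mul, map_mul] at hu
  have hus : IsUnit (ψ s) := isUnit_of_mul_isUnit_left (isUnit_of_mul_isUnit_left hu)
  have hus' : IsUnit (ψ s') := isUnit_of_mul_isUnit_right (isUnit_of_mul_isUnit_left hu)
  have hut : IsUnit (ψ t) := isUnit_of_mul_isUnit_right hu
  have hMB : M.map ψ = ψ s • B := by
    ext i j
    exact ((hB i j).map_mul_eq (congrFun (congrFun hM i) j).symm).symm
  have hMB' : M'.map ψ = ψ s' • B' := by
    ext i j
    exact ((hB' i j).map_mul_eq (congrFun (congrFun hM' i) j).symm).symm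
  apply le_antisymm
  · intro x hx
    obtain ⟨d, hd, x', hx'⟩ := exists_common_denom (algebraMap (Ra k K n α) Sα) ℘.primeCompl
      (fun a => by
        obtain ⟨⟨f, g⟩, hfg⟩ := IsLocalization.surj ℘.primeCompl a
        exact ⟨g, g.2, f, by rw [mul_comm]; exact hfg⟩) x
    have hinj : Function.Injective (algebraMap (Ra k K n α) Sα) :=
      IsLocalization.injective Sα ℘.primeCompl_le_nonZeroDivisors
    have hx'' : algebraMap (Ra k K n α) Sα ∘ x' = algebraMap (Ra k K n α) Sα d • x := by
      ext1 i
      exact (hx' i).symm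
    have hxB : B.mulVec x = 0 := hx
    obtain ⟨z, hz, b, hb, hzb⟩ := hlift (evalα k K α) (exists_denom_evalα α) hα x' (by
      ext1 i
      apply hinj
      rw [RingHom.map_mulVec, Matrix.map_map, hx'', Matrix.mulVec_smul]
      change (algebraMap (Ra k K n α) Sα d • (M.map ψ).mulVec x) i = _
      rw [hMB, Matrix.smul_mulVec, hxB]
      simp)
    obtain ⟨u, hu⟩ := hker z hz
    have hzx : ψ ∘ z = (algebraMap (Ra k K n α) Sα (C b) * algebraMap (Ra k K n α) Sα d) • x := by
      ext1 i
      change algebraMap (Ra k K n α) Sα (toRa k K n α (z i)) = _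
      rw [toRa, hzb, map_mul, ← hx', Pi.smul_apply, smul_eq_mul, mul_assoc]
    have hub : IsUnit (algebraMap (Ra k K n α) Sα (C b)) := (hb.isUnit.map C).map _
    have hud : IsUnit (algebraMap (Ra k K n α) Sα d) :=
      IsLocalization.map_units Sα (⟨d, hd⟩ : ℘.primeCompl)
    rw [← Submodule.smul_mem_iff_of_isUnit _ ((hut.mul hus').mul (hub.mul hud)), mul_smul, ← hzx]
    refine ⟨ψ s' • (ψ ∘ u), ?_⟩
    rw [map_smul, Matrix.mulVecLin_apply, ← Matrix.smul_mulVec, ← hMB']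
    ext1 i
    rw [← RingHom.map_mulVec, hu]
    simp
  · rw [LinearMap.range_le_ker_iff, ← Matrix.mulVecLin_mul]
    have : (ψ s * ψ s') • (B * B') = 0 := by
      rw [mul_smul, ← Matrix.mul_smul, ← hMB', ← Matrix.smul_mul, ← hMB, ← Matrix.map_mul, hMM']
      simp
    rw [(hus.mul hus').smul_eq_zero.1 this, Matrix.mulVecLin_zero]

end Specialization

/-- if `F• : 0 → F_ℓ → ⋯ → F_1 → F_0` is an exact complex of finitely
generated free `S`-modules (the map `F_{j+1} → F_j` being given by the matrix
`A j`), then for almost all `α` the specialized complex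
`(F•)_α : 0 → (F_ℓ)_α → ⋯ → (F_0)_α` (given by any entrywise specializations
`B j` of the matrices `A j`) is an exact complex of free `S_α`-modules. -/
theorem specialization_preserves_exactness_of_free_complexes
    (k K : Type) [Field k] [Field K] [Algebra k K] [Infinite K] {m n : ℕ}
    (P : Ideal (Rg k m n)) [P.IsPrime]
    (S : Type) [CommRing S] [Algebra (Rg k m n) S] [IsLocalization.AtPrime S P]
    (ℓ : ℕ) (hℓ : 0 < ℓ) (r : ℕ → ℕ)
    (A : ∀ j : ℕ, Matrix (Fin (r j)) (Fin (r (j + 1))) S)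
    (hex : ∀ j : ℕ, j + 1 < ℓ →
      LinearMap.ker (A j).mulVecLin = LinearMap.range (A (j + 1)).mulVecLin)
    (hinj : LinearMap.ker (A (ℓ - 1)).mulVecLin = ⊥) :
    AlmostAll K m fun α =>
      ∀ (℘ : Ideal (Ra k K n α))
        (h℘ : IsAssociatedPrime ℘ ((Ra k K n α) ⧸ idealSpec k K n α P)),
        haveI := h℘.isPrime
        ∀ (Sα : Type) [CommRing Sα] [Algebra (Ra k K n α) Sα]
          [IsLocalization.AtPrime Sα ℘]
          (B : ∀ j : ℕ, Matrix (Fin (r j)) (Fin (r (j + 1))) Sα),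
          (∀ j : ℕ, j < ℓ → MatSpec (LocElemSpec P ℘) (A j) (B j)) →
          (∀ j : ℕ, j + 1 < ℓ →
            LinearMap.ker (B j).mulVecLin = LinearMap.range (B (j + 1)).mulVecLin) ∧
          LinearMap.ker (B (ℓ - 1)).mulVecLin = ⊥ := by
  have hlast : LinearMap.ker (A (ℓ - 1)).mulVecLin =
      LinearMap.range (0 : Matrix (Fin (r (ℓ - 1 + 1))) (Fin 0) S).mulVecLin := by
    rw [hinj, Matrix.mulVecLin_zero, LinearMap.range_zero]
  have hall : AlmostAll K m fun α => ∀ j < ℓ - 1, _ :=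
    AlmostAll.forall_lt fun j hj => almostAll_ker_eq_range K P (hex j (by omega))
  refine (hall.and (almostAll_ker_eq_range K P hlast)).mono ?_
  rintro α ⟨h₁, h₂⟩ ℘ h℘ Sα _ _ _ B hB
  refine ⟨fun j hj => h₁ j (by omega) ℘ h℘ Sα _ _ (hB j (by omega)) (hB (j + 1) hj), ?_⟩
  rw [h₂ ℘ h℘ Sα _ 0 (hB (ℓ - 1) (by omega)) fun _ j => j.elim0, Matrix.mulVecLin_zero,
    LinearMap.range_zero]

end Spl
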